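/- The lowered curvature of the full connection Γ = {Γ} + K of a generalised pp-wave with purely axial torsion is given explicitly by g_{κρ} R[Γ]^ρ_{λμν} = −½ (l_κ ∂_λ − l_λ ∂_κ)(l_μ ∂_ν − l_ν ∂_μ) f + ¼ k(x³)² Re( F_{κλ} F̄_{μν} ) − ½ k′(x³) Im( F_{κλ} F̄_{μν} ) for all κ, λ, μ, ν. -/

import Mathlib

noncomputable section

open scoped BigOperators

/-- Points of spacetime: ℝ⁴ with coordinates x⁰, x¹, x², x³. -/
abbrev Spacetime := Fin 4 → ℝ

/-- Partial derivative ∂_μ of a scalar function. -/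
def pd (μ : Fin 4) (h : Spacetime → ℝ) : Spacetime → ℝ :=
  fun x => fderiv ℝ h x (Pi.single μ 1)

/-- The pp-metric g_{μν}: nonzero components g₀₃ = g₃₀ = 1, g₁₁ = g₂₂ = −1, g₃₃ = f. -/
def ppMetric (f : Spacetime → ℝ) (x : Spacetime) (μ ν : Fin 4) : ℝ :=
  if μ = 0 ∧ ν = 3 then 1 else if μ = 3 ∧ ν = 0 then 1
  else if μ = 1 ∧ ν = 1 then -1 else if μ = 2 ∧ ν = 2 then -1
  else if μ = 3 ∧ ν = 3 then f x else 0

/-- The pointwise inverse metric g^{μν}: g⁰⁰ = −f, g⁰³ = g³⁰ = 1, g¹¹ = g²² = −1. -/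
def ppMetricInv (f : Spacetime → ℝ) (x : Spacetime) (μ ν : Fin 4) : ℝ :=
  if μ = 0 ∧ ν = 0 then -(f x) else if μ = 0 ∧ ν = 3 then 1
  else if μ = 3 ∧ ν = 0 then 1
  else if μ = 1 ∧ ν = 1 then -1 else if μ = 2 ∧ ν = 2 then -1 else 0

/-- Christoffel symbols {Γ}^λ_{μν} = ½ g^{λκ}(∂_μ g_{κν} + ∂_ν g_{κμ} − ∂_κ g_{μν}). -/
def christoffel (f : Spacetime → ℝ) (x : Spacetime) (l μ ν : Fin 4) : ℝ :=
  (1/2) * ∑ κ, ppMetricInv f x l κ *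
    (pd μ (fun y => ppMetric f y κ ν) x + pd ν (fun y => ppMetric f y κ μ) x
      - pd κ (fun y => ppMetric f y μ ν) x)

/-- Totally antisymmetric symbol ε with ε₀₁₂₃ = 1. -/
def eps (a b c d : Fin 4) : ℝ :=
  ((((b:ℕ):ℝ) - ((a:ℕ):ℝ)) * (((c:ℕ):ℝ) - ((a:ℕ):ℝ)) * (((d:ℕ):ℝ) - ((a:ℕ):ℝ)) *
    (((c:ℕ):ℝ) - ((b:ℕ):ℝ)) * (((d:ℕ):ℝ) - ((b:ℕ):ℝ)) * (((d:ℕ):ℝ) - ((c:ℕ):ℝ))) / 12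

/-- Purely axial torsion T_{κμν} = k(x³) ε_{0κμν}. -/
def torsion (k : ℝ → ℝ) (x : Spacetime) (κ μ ν : Fin 4) : ℝ :=
  k (x 3) * eps 0 κ μ ν

/-- Contorsion K^κ_{μν} = ½ g^{κρ} T_{ρμν}. -/
def contorsion (f : Spacetime → ℝ) (k : ℝ → ℝ) (x : Spacetime) (κ μ ν : Fin 4) : ℝ :=
  (1/2) * ∑ ρ, ppMetricInv f x κ ρ * torsion k x ρ μ ν

/-- The full connection Γ^λ_{μν} = {Γ}^λ_{μν} + K^λ_{μν}. -/
def fullConn (f : Spacetime → ℝ) (k : ℝ → ℝ) (x : Spacetime) (κ μ ν : Fin 4) : ℝ :=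
  christoffel f x κ μ ν + contorsion f k x κ μ ν

/-- Curvature R[A]^κ_{λμν} of connection coefficients A^κ_{μν}. -/
def curv (A : Spacetime → Fin 4 → Fin 4 → Fin 4 → ℝ) (x : Spacetime)
    (κ l μ ν : Fin 4) : ℝ :=
  pd μ (fun y => A y κ ν l) x - pd ν (fun y => A y κ μ l) x
    + ∑ η, (A x κ μ η * A x η ν l - A x κ ν η * A x η μ l)

/-- The parallel null vector field l^μ = (1,0,0,0). -/
def lUp : Fin 4 → ℝ := fun μ => if μ = 0 then 1 else 0

/-- The lowered vector l_μ = g_{μν} l^ν = (0,0,0,1). -/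
def lCov : Fin 4 → ℝ := fun μ => if μ = 3 then 1 else 0

/-- The complex vector m_μ = (0,−1,i,0). -/
def mCov : Fin 4 → ℂ := ![0, -1, Complex.I, 0]

/-- l_μ regarded as a complex vector. -/
def lCovC : Fin 4 → ℂ := fun μ => if μ = 3 then 1 else 0

/-- The bivector F_{κλ} = (l ∧ m)_{κλ} = l_κ m_λ − m_κ l_λ. -/
def Fbiv (κ l : Fin 4) : ℂ := lCovC κ * mCov l - mCov κ * lCovC l

/-- The contorsion coefficients `η^{aρ} ε_{0ρμν}`. -/
def axialCoeff (a μ ν : Fin 4) : ℝ :=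
  if a = 0 then eps 0 3 μ ν else if a = 3 then 0 else -eps 0 a μ ν

/-- The indicator of the transverse indices `1` and `2`. -/
def transverse (a : Fin 4) : ℝ := if a = 1 ∨ a = 2 then 1 else 0

/-- The connection coefficients as a function of the gradient `d` of `f` and the value `t` of `k`. -/
def connForm (d : Fin 4 → ℝ) (t : ℝ) (a μ ν : Fin 4) : ℝ :=
  lUp a * lCov ν / 2 * d μ + lUp a * lCov μ / 2 * d ν - lUp a * lCov μ * lCov ν / 2 * d 3
    + transverse a * lCov μ * lCov ν / 2 * d a + axialCoeff a μ ν / 2 * t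

lemma pd_ppMetric (f : Spacetime → ℝ) (x : Spacetime) (σ μ ν : Fin 4) :
    pd σ (fun y => ppMetric f y μ ν) x = lCov μ * lCov ν * pd σ f x := by
  fin_cases μ <;> fin_cases ν <;> simp [ppMetric, pd, lCov]

lemma fullConn_eq_connForm (f : Spacetime → ℝ) (h0 : ∀ x, pd 0 f x = 0) (k : ℝ → ℝ)
    (x : Spacetime) (a μ ν : Fin 4) :
    fullConn f k x a μ ν = connForm (fun σ => pd σ f x) (k (x 3)) a μ ν := by
  have e0 : eps 0 0 μ ν = 0 := by simp [eps]
  simp only [fullConn, christoffel, contorsion, torsion, pd_ppMetric, Fin.sum_univ_four]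
  fin_cases a <;>
    simp [ppMetricInv, connForm, axialCoeff, transverse, lUp, h0, e0, show lCov 0 = 0 from rfl,
      show lCov 1 = 0 from rfl, show lCov 2 = 0 from rfl, show lCov 3 = 1 from rfl] <;>
    ring

lemma differentiable_pd {f : Spacetime → ℝ} (hf : ContDiff ℝ 2 f) (μ : Fin 4) :
    Differentiable ℝ (pd μ f) :=
  ((hf.fderiv_right (m := 1) (by norm_num)).clm_apply contDiff_const).differentiable (by norm_num)

lemma pd_pd_comm {f : Spacetime → ℝ} (hf : ContDiff ℝ 2 f) (μ ν : Fin 4) (x : Spacetime) :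
    pd μ (pd ν f) x = pd ν (pd μ f) x := by
  have hd : DifferentiableAt ℝ (fderiv ℝ f) x :=
    (hf.fderiv_right (m := 1) (by norm_num)).differentiable (by norm_num) x
  have key (a b : Fin 4) : pd a (pd b f) x =
      fderiv ℝ (fderiv ℝ f) x (Pi.single a 1) (Pi.single b 1) := by
    change fderiv ℝ (fun y => fderiv ℝ f y (Pi.single b 1)) x (Pi.single a 1) = _
    rw [fderiv_clm_apply hd (differentiableAt_const _)]
    simp
  rw [key, key]
  exact (hf.contDiffAt.isSymmSndFDerivAt (by simp)).eq _ _

lemma hasFDerivAt_comp_coord {k : ℝ → ℝ} (hk : Differentiable ℝ k) (x : Spacetime) (i : Fin 4) :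
    HasFDerivAt (fun y : Spacetime => k (y i))
      (deriv k (x i) • ContinuousLinearMap.proj (R := ℝ) (φ := fun _ : Fin 4 => ℝ) i) x :=
  (hk (x i)).hasDerivAt.comp_hasFDerivAt x
    (ContinuousLinearMap.proj (R := ℝ) (φ := fun _ : Fin 4 => ℝ) i).hasFDerivAt

lemma pd_fullConn {f : Spacetime → ℝ} (hf : ContDiff ℝ 2 f) (h0 : ∀ x, pd 0 f x = 0)
    {k : ℝ → ℝ} (hk : Differentiable ℝ k) (x : Spacetime) (σ a μ ν : Fin 4) :
    pd σ (fun y => fullConn f k y a μ ν) x =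
      connForm (fun τ => pd σ (pd τ f) x) (lCov σ * deriv k (x 3)) a μ ν := by
  have hd (τ : Fin 4) := (differentiable_pd hf τ x).hasFDerivAt
  have h := (((((hd μ).const_mul (lUp a * lCov ν / 2)).add
    ((hd ν).const_mul (lUp a * lCov μ / 2))).sub
    ((hd 3).const_mul (lUp a * lCov μ * lCov ν / 2))).add
    ((hd a).const_mul (transverse a * lCov μ * lCov ν / 2))).add
    ((hasFDerivAt_comp_coord hk x 3).const_mul (axialCoeff a μ ν / 2))
  have hfun : (fun y => fullConn f k y a μ ν) =
      fun y => connForm (fun τ => pd τ f y) (k (y 3)) a μ ν :=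
    funext fun y => fullConn_eq_connForm f h0 k y a μ ν
  have hcoord : (Pi.single σ (1 : ℝ) : Spacetime) 3 = lCov σ := by
    simp [Pi.single_apply, lCov, eq_comm]
  rw [hfun]
  refine (congrArg (fun L => L (Pi.single σ 1)) h.fderiv).trans ?_
  simp [connForm, hcoord, pd, mul_comm (lCov σ)]

lemma connForm_three (d : Fin 4 → ℝ) (t : ℝ) (μ ν : Fin 4) : connForm d t 3 μ ν = 0 := by
  simp [connForm, axialCoeff, transverse, lUp]

lemma connForm_right_zero {d : Fin 4 → ℝ} (hd : d 0 = 0) (t : ℝ) (a μ : Fin 4) :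
    connForm d t a μ 0 = 0 := by
  simp [connForm, axialCoeff, lCov, eps, hd]

lemma sum_ppMetric_mul (f : Spacetime → ℝ) (x : Spacetime) (κ : Fin 4) (v : Fin 4 → ℝ) :
    ∑ ρ, ppMetric f x κ ρ * v ρ =
      if κ = 0 then v 3 else if κ = 3 then v 0 + f x * v 3 else -v κ := by
  fin_cases κ <;> simp [Fin.sum_univ_four, ppMetric]

set_option maxHeartbeats 2000000 in
/-- The curvature identity as polynomial algebra in the derivatives `d`, `H` of `f` and the
values `t`, `dt` of `k` and its derivative. -/
lemma curvature_algebra (f : Spacetime → ℝ) (t dt : ℝ) (d : Fin 4 → ℝ) (H : Fin 4 → Fin 4 → ℝ)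
    (hd : d 0 = 0) (hH : ∀ a, H a 0 = 0) (hs : ∀ a b, H a b = H b a) (x : Spacetime)
    (κ lam μ ν : Fin 4) :
    (∑ ρ, ppMetric f x κ ρ *
      (connForm (H μ) (lCov μ * dt) ρ ν lam - connForm (H ν) (lCov ν * dt) ρ μ lam
        + ∑ η, (connForm d t ρ μ η * connForm d t η ν lam
          - connForm d t ρ ν η * connForm d t η μ lam))) =
      -(1/2) * (lCov κ * lCov μ * H lam ν - lCov κ * lCov ν * H lam μ
          - lCov lam * lCov μ * H κ ν + lCov lam * lCov ν * H κ μ)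
        + (1/4) * t^2 * (Fbiv κ lam * (starRingEnd ℂ) (Fbiv μ ν)).re
        - (1/2) * dt * (Fbiv κ lam * (starRingEnd ℂ) (Fbiv μ ν)).im := by
  have hH₀ (a : Fin 4) : H 0 a = 0 := (hs 0 a).trans (hH a)
  have h21 := hs 2 1
  have h31 := hs 3 1
  have h32 := hs 3 2
  have hquad : ∀ ρ, (∑ η, (connForm d t ρ μ η * connForm d t η ν lam
      - connForm d t ρ ν η * connForm d t η μ lam)) =
      connForm d t ρ μ 1 * connForm d t 1 ν lam - connForm d t ρ ν 1 * connForm d t 1 μ lam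
      + (connForm d t ρ μ 2 * connForm d t 2 ν lam
        - connForm d t ρ ν 2 * connForm d t 2 μ lam) := by
    intro ρ
    simp [Fin.sum_univ_four, connForm_three, connForm_right_zero hd]
    ring
  simp only [hquad, sum_ppMetric_mul f x κ]
  fin_cases κ <;> simp [connForm_three] <;>
    fin_cases lam <;> fin_cases μ <;> fin_cases ν <;>
    simp [connForm, axialCoeff, transverse, lUp, lCov, eps, Fbiv, lCovC, mCov,
      hd, hH, hH₀, h21, h31, h32] <;>
    ring_nf <;> simp

/-- explicit formula for the lowered curvature of the full connection of
a generalised pp-wave with purely axial torsion. -/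
theorem full_curvature_explicit_formula
    (f : Spacetime → ℝ) (hf : ContDiff ℝ (⊤ : ℕ∞) f) (h0 : ∀ x, pd 0 f x = 0)
    (k : ℝ → ℝ) (hk : ContDiff ℝ (⊤ : ℕ∞) k) :
    ∀ (x : Spacetime) (κ lam μ ν : Fin 4),
      (∑ ρ, ppMetric f x κ ρ * curv (fullConn f k) x ρ lam μ ν) =
        -(1/2) * (lCov κ * lCov μ * pd lam (pd ν f) x
          - lCov κ * lCov ν * pd lam (pd μ f) x
          - lCov lam * lCov μ * pd κ (pd ν f) x
          + lCov lam * lCov ν * pd κ (pd μ f) x)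
        + (1/4) * (k (x 3))^2 * (Fbiv κ lam * (starRingEnd ℂ) (Fbiv μ ν)).re
        - (1/2) * deriv k (x 3) * (Fbiv κ lam * (starRingEnd ℂ) (Fbiv μ ν)).im := by
  intro x κ lam μ ν
  have hf2 : ContDiff ℝ 2 f := hf.of_le (WithTop.coe_le_coe.2 le_top)
  have hk1 : Differentiable ℝ k := hk.differentiable (by simp)
  have hH (a : Fin 4) : pd a (pd 0 f) x = 0 := by
    simp [pd, show pd 0 f = fun _ => 0 from funext h0]
  simp only [curv, pd_fullConn hf2 h0 hk1]
  simp only [fullConn_eq_connForm f h0]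
  exact curvature_algebra f (k (x 3)) (deriv k (x 3)) (fun σ => pd σ f x)
    (fun a b => pd a (pd b f) x) (h0 x) hH (fun a b => pd_pd_comm hf2 a b x) x κ lam μ ν
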